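/- arXiv:1908.01193 — 6 statements merged into one kernel-verified Lean document; each statement's English description precedes it below -/
import Mathlib

section
/- Let Γ be the free product (ℤ/2ℤ × ℤ/2ℤ) * (ℤ/2ℤ), with R0 and R2 the images of (1,0) and (0,1) from the first free factor and R1 the image of the generator of the second free factor. Set S1 = R1, S2 = R0·R1·R0, S3 = R2. Then each Si has order 2, the canonical homomorphism from the free product (ℤ/2ℤ) * (ℤ/2ℤ) * (ℤ/2ℤ) to Γ sending the generator of the i-th free factor to Si is injective, and its image (the subgroup of Γ generated by S1, S2, S3) has index 2 in Γ. -/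
/-- `Γ` is the free product `(ℤ/2ℤ × ℤ/2ℤ) ∗ (ℤ/2ℤ)` underlying the algebraic theory of maps. -/
abbrev Γ : Type := Monoid.Coprod (Multiplicative (ZMod 2 × ZMod 2)) (Multiplicative (ZMod 2))

/-- `R0` is the image of `(1,0)` from the first free factor. -/
def R0 : Γ := Monoid.Coprod.inl (Multiplicative.ofAdd ((1, 0) : ZMod 2 × ZMod 2))

/-- `R1` is the image of the generator of the second free factor. -/
def R1 : Γ := Monoid.Coprod.inr (Multiplicative.ofAdd (1 : ZMod 2))

/-- `R2` is the image of `(0,1)` from the first free factor. -/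
def R2 : Γ := Monoid.Coprod.inl (Multiplicative.ofAdd ((0, 1) : ZMod 2 × ZMod 2))

open Monoid

/-- The homomorphism `ℤ/2ℤ → G` sending the generator to an involution `g`. -/
def involutionHom {G : Type*} [Group G] (g : G) (hg : g * g = 1) : Multiplicative (ZMod 2) →* G :=
  MonoidHom.mk' (fun x => g ^ (ZMod.val x.toAdd)) <| by
    have key : ∀ a b : ZMod 2, g ^ (a + b).val = g ^ a.val * g ^ b.val := by
      intro a b
      have h2 : ∀ c : ZMod 2, c = 0 ∨ c = 1 := by decide
      rcases h2 a with rfl | rfl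
      · simp
      rcases h2 b with rfl | rfl
      · simp
      · change g ^ 0 = g ^ 1 * g ^ 1
        simp [hg]
    exact fun a b => key a.toAdd b.toAdd

theorem involutionHom_ofAdd_one {G : Type*} [Group G] (g : G) (hg : g * g = 1) :
    involutionHom g hg (Multiplicative.ofAdd 1) = g :=
  pow_one g

/-- The homomorphism `ℤ/2ℤ × ℤ/2ℤ → G` given by a pair of commuting involutions. -/
def commutingInvolutionsHom {G : Type*} [Group G] (g h : G) (hg : g * g = 1) (hh : h * h = 1)
    (hgh : Commute g h) : Multiplicative (ZMod 2 × ZMod 2) →* G :=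
  ((involutionHom g hg).noncommCoprod (involutionHom h hh)
    fun _ _ => hgh.pow_pow _ _).comp
    (MulEquiv.prodMultiplicative (ZMod 2) (ZMod 2)).toMonoidHom

theorem commutingInvolutionsHom_fst {G : Type*} [Group G] (g h : G) (hg : g * g = 1)
    (hh : h * h = 1) (hgh : Commute g h) :
    commutingInvolutionsHom g h hg hh hgh (Multiplicative.ofAdd (1, 0)) = g := by
  change g ^ 1 * h ^ 0 = g
  simp

theorem commutingInvolutionsHom_snd {G : Type*} [Group G] (g h : G) (hg : g * g = 1)
    (hh : h * h = 1) (hgh : Commute g h) :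
    commutingInvolutionsHom g h hg hh hgh (Multiplicative.ofAdd (0, 1)) = h := by
  change g ^ 0 * h ^ 1 = h
  simp

theorem monoidHom_multiplicative_zmod_two_ext {G : Type*} [Group G]
    {f g : Multiplicative (ZMod 2) →* G}
    (h : f (Multiplicative.ofAdd 1) = g (Multiplicative.ofAdd 1)) : f = g := by
  refine MonoidHom.ext fun x => ?_
  have hx : ∀ y : Multiplicative (ZMod 2), y = 1 ∨ y = Multiplicative.ofAdd 1 := by decide
  rcases hx x with rfl | rfl
  · simp
  · exact h

/-- The free product of copies of `ℤ/2ℤ` indexed by `ι`. -/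
abbrev InvolutionCoprod (ι : Type*) : Type _ := CoprodI (fun _ : ι => Multiplicative (ZMod 2))

namespace InvolutionCoprod

variable {ι : Type*}

/-- The generator of the `i`-th free factor. -/
def gen (i : ι) : InvolutionCoprod ι :=
  CoprodI.of (M := fun _ : ι => Multiplicative (ZMod 2)) (i := i) (Multiplicative.ofAdd 1)

theorem gen_mul_self (i : ι) : gen i * gen i = 1 := by
  rw [gen, ← map_mul]
  exact map_one _

/-- The homomorphism out of a free product of copies of `ℤ/2ℤ` given by a family of involutions. -/
def lift {G : Type*} [Group G] (s : ι → G) (hs : ∀ i, s i * s i = 1) : InvolutionCoprod ι →* G :=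
  CoprodI.lift fun i => involutionHom (s i) (hs i)

theorem lift_gen {G : Type*} [Group G] (s : ι → G) (hs : ∀ i, s i * s i = 1) (i : ι) :
    lift s hs (gen i) = s i := by
  rw [lift, gen, CoprodI.lift_of, involutionHom_ofAdd_one]

theorem hom_ext {G : Type*} [Group G] {f g : InvolutionCoprod ι →* G}
    (h : ∀ i, f (gen i) = g (gen i)) : f = g :=
  CoprodI.ext_hom _ _ fun i => monoidHom_multiplicative_zmod_two_ext (h i)

theorem range_lift {G : Type*} [Group G] (s : ι → G) (hs : ∀ i, s i * s i = 1) :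
    (lift s hs).range = Subgroup.closure (Set.range s) := by
  apply le_antisymm
  · refine CoprodI.lift_range_le _ (fun i => involutionHom (s i) (hs i)) ?_
    rintro i _ ⟨x, rfl⟩
    exact pow_mem (Subgroup.subset_closure (Set.mem_range_self i)) _
  · rw [Subgroup.closure_le]
    rintro _ ⟨i, rfl⟩
    exact ⟨gen i, lift_gen s hs i⟩

/-- The endomorphism permuting the free factors according to `e`. -/
def permHom (e : ι → ι) : InvolutionCoprod ι →* InvolutionCoprod ι :=
  lift (fun i => gen (e i)) fun _ => gen_mul_self _

theorem permHom_comp_self {e : ι → ι} (he : Function.Involutive e) :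
    (permHom e).comp (permHom e) = MonoidHom.id _ :=
  hom_ext fun i => by simp [permHom, lift_gen, he i]

/-- The automorphism permuting the free factors according to an involutive map `e`. -/
def permAut (e : ι → ι) (he : Function.Involutive e) : MulAut (InvolutionCoprod ι) :=
  (permHom e).toMulEquiv (permHom e) (permHom_comp_self he) (permHom_comp_self he)

theorem permAut_gen (e : ι → ι) (he : Function.Involutive e) (i : ι) :
    permAut e he (gen i) = gen (e i) :=
  lift_gen (fun i => gen (e i)) (fun _ => gen_mul_self _) i

theorem permAut_mul_self (e : ι → ι) (he : Function.Involutive e) :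
    permAut e he * permAut e he = 1 :=
  MulEquiv.ext fun x => DFunLike.congr_fun (permHom_comp_self he) x

end InvolutionCoprod

open InvolutionCoprod

/-- The action of `ℤ/2ℤ` on `ℤ/2ℤ ∗ ℤ/2ℤ ∗ ℤ/2ℤ` exchanging the first two free factors. -/
def swapAction : Multiplicative (ZMod 2) →* MulAut (InvolutionCoprod (Fin 3)) :=
  involutionHom (permAut (Equiv.swap 0 1) (Equiv.swap_apply_self 0 1)) (permAut_mul_self _ _)

/-- The semidirect product by the swap of the first two free factors. -/
abbrev SwapProduct : Type := InvolutionCoprod (Fin 3) ⋊[swapAction] Multiplicative (ZMod 2)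

theorem swapProduct_conj (i : Fin 3) :
    (SemidirectProduct.inr (Multiplicative.ofAdd 1) * SemidirectProduct.inl (gen i) : SwapProduct) =
      SemidirectProduct.inl (gen (Equiv.swap 0 1 i)) *
        SemidirectProduct.inr (Multiplicative.ofAdd 1) := by
  rw [← permAut_gen _ (Equiv.swap_apply_self 0 1) i]
  have h : permAut (Equiv.swap 0 1) (Equiv.swap_apply_self 0 1) =
      swapAction (Multiplicative.ofAdd 1) := (involutionHom_ofAdd_one _ _).symm
  rw [h, SemidirectProduct.inl_aut, map_inv, inv_mul_cancel_right]

theorem swapProduct_commute : Commute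
    (SemidirectProduct.inr (Multiplicative.ofAdd 1) : SwapProduct)
    (SemidirectProduct.inl (gen 2)) :=
  swapProduct_conj 2

theorem swapProduct_inl_gen_mul_self (i : Fin 3) :
    (SemidirectProduct.inl (gen i) * SemidirectProduct.inl (gen i) : SwapProduct) = 1 := by
  rw [← map_mul, gen_mul_self, map_one]

theorem swapProduct_inr_mul_self :
    (SemidirectProduct.inr (Multiplicative.ofAdd 1) *
      SemidirectProduct.inr (Multiplicative.ofAdd 1) : SwapProduct) = 1 := by
  rw [← map_mul]
  exact map_one _

/-- The homomorphism from `Γ` to the semidirect product with `R0` acting as the swap. -/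
def toSwapProduct : Γ →* SwapProduct :=
  Coprod.lift
    (commutingInvolutionsHom (SemidirectProduct.inr (Multiplicative.ofAdd 1))
      (SemidirectProduct.inl (gen 2)) swapProduct_inr_mul_self (swapProduct_inl_gen_mul_self 2)
      swapProduct_commute)
    (involutionHom (SemidirectProduct.inl (gen 0)) (swapProduct_inl_gen_mul_self 0))

theorem toSwapProduct_R0 :
    toSwapProduct R0 = SemidirectProduct.inr (Multiplicative.ofAdd 1) := by
  rw [toSwapProduct, R0, Coprod.lift_apply_inl, commutingInvolutionsHom_fst]

theorem toSwapProduct_R1 : toSwapProduct R1 = SemidirectProduct.inl (gen 0) := by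
  rw [toSwapProduct, R1, Coprod.lift_apply_inr, involutionHom_ofAdd_one]

theorem toSwapProduct_R2 : toSwapProduct R2 = SemidirectProduct.inl (gen 2) := by
  rw [toSwapProduct, R2, Coprod.lift_apply_inl, commutingInvolutionsHom_snd]

theorem R0_mul_self : R0 * R0 = 1 := by
  rw [R0, ← map_mul]
  exact map_one _

theorem R1_mul_self : R1 * R1 = 1 := by
  rw [R1, ← map_mul]
  exact map_one _

theorem R2_mul_self : R2 * R2 = 1 := by
  rw [R2, ← map_mul]
  exact map_one _

theorem R0_mul_R2 : R0 * R2 = R2 * R0 := by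
  rw [R0, R2, ← map_mul Coprod.inl, ← map_mul Coprod.inl, mul_comm]

theorem R0_conj_R1_mul_self : R0 * R1 * R0 * (R0 * R1 * R0) = 1 := by
  calc R0 * R1 * R0 * (R0 * R1 * R0) = R0 * (R1 * (R0 * R0) * R1) * R0 := by group
    _ = 1 := by rw [R0_mul_self, mul_one, R1_mul_self, mul_one, R0_mul_self]

/-- The three involutions generating the parent group `N(2)`. -/
def parentGens : Fin 3 → Γ := ![R1, R0 * R1 * R0, R2]

theorem parentGens_mul_self (i : Fin 3) : parentGens i * parentGens i = 1 := by
  fin_cases i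
  exacts [R1_mul_self, R0_conj_R1_mul_self, R2_mul_self]

theorem range_parentGens : Set.range parentGens = {R1, R0 * R1 * R0, R2} := by
  ext g
  simp [parentGens]
  tauto

theorem toSwapProduct_parentGens (i : Fin 3) :
    toSwapProduct (parentGens i) = SemidirectProduct.inl (gen i) := by
  fin_cases i
  · exact toSwapProduct_R1
  · change toSwapProduct (R0 * R1 * R0) = _
    rw [map_mul, map_mul, toSwapProduct_R0, toSwapProduct_R1, swapProduct_conj, mul_assoc,
      swapProduct_inr_mul_self, mul_one]
    rfl
  · exact toSwapProduct_R2

theorem toSwapProduct_comp_lift :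
    toSwapProduct.comp (lift parentGens parentGens_mul_self) = SemidirectProduct.inl :=
  hom_ext fun i => by rw [MonoidHom.comp_apply, lift_gen, toSwapProduct_parentGens]

theorem lift_parentGens_injective :
    Function.Injective (lift parentGens parentGens_mul_self) := by
  apply Function.Injective.of_comp (f := toSwapProduct)
  rw [← MonoidHom.coe_comp, toSwapProduct_comp_lift]
  exact SemidirectProduct.inl_injective

theorem gen_ne_one {ι : Type*} (i : ι) : gen i ≠ 1 := by
  classical
  intro h
  have h' := CoprodI.of_injective (M := fun _ : ι => Multiplicative (ZMod 2)) i
    (h.trans (map_one _).symm)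
  revert h'
  decide

theorem orderOf_parentGens (i : Fin 3) : orderOf (parentGens i) = 2 := by
  refine orderOf_eq_prime (by rw [pow_two, parentGens_mul_self]) fun h => gen_ne_one i ?_
  apply lift_parentGens_injective
  rw [lift_gen, h, map_one]

theorem closure_R0_R1_R2 : Subgroup.closure {R0, R1, R2} = (⊤ : Subgroup Γ) := by
  have h0 : R0 ∈ Subgroup.closure {R0, R1, R2} := Subgroup.subset_closure (by simp)
  have h1 : R1 ∈ Subgroup.closure {R0, R1, R2} := Subgroup.subset_closure (by simp)
  have h2 : R2 ∈ Subgroup.closure {R0, R1, R2} := Subgroup.subset_closure (by simp)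
  have hx : ∀ x : Multiplicative (ZMod 2 × ZMod 2), x = 1 ∨ x = Multiplicative.ofAdd (1, 0) ∨
    x = Multiplicative.ofAdd (0, 1) ∨
      x = Multiplicative.ofAdd (1, 0) * Multiplicative.ofAdd (0, 1) := by decide
  have hy : ∀ y : Multiplicative (ZMod 2), y = 1 ∨ y = Multiplicative.ofAdd 1 := by decide
  rw [eq_top_iff]
  rintro g -
  induction g using Coprod.induction_on with
  | inl x =>
    rcases hx x with rfl | rfl | rfl | rfl
    · rw [map_one]; exact one_mem _
    · exact h0
    · exact h2
    · rw [map_mul]; exact mul_mem h0 h2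
  | inr y =>
    rcases hy y with rfl | rfl
    · rw [map_one]; exact one_mem _
    · exact h1
  | mul a b ha hb => exact mul_mem ha hb

theorem right_toSwapProduct_of_mem {g : Γ} (hg : g ∈ Subgroup.closure (Set.range parentGens)) :
    (toSwapProduct g).right = 1 := by
  rw [← range_lift _ parentGens_mul_self] at hg
  obtain ⟨w, rfl⟩ := hg
  rw [← MonoidHom.comp_apply, toSwapProduct_comp_lift, SemidirectProduct.right_inl]

theorem mem_or_mul_R0_mem (g : Γ) :
    g ∈ Subgroup.closure (Set.range parentGens) ∨
      g * R0 ∈ Subgroup.closure (Set.range parentGens) := by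
  have hS (i) : parentGens i ∈ Subgroup.closure (Set.range parentGens) :=
    Subgroup.subset_closure ⟨i, rfl⟩
  have h1 : R1 ∈ Subgroup.closure (Set.range parentGens) := hS 0
  have h01 : R0 * R1 * R0 ∈ Subgroup.closure (Set.range parentGens) := hS 1
  have h2 : R2 ∈ Subgroup.closure (Set.range parentGens) := hS 2
  have hinv : ∀ x ∈ ({R0, R1, R2} : Set Γ), x⁻¹ = x := by
    rintro x (rfl | rfl | rfl)
    exacts [inv_eq_of_mul_eq_one_right R0_mul_self, inv_eq_of_mul_eq_one_right R1_mul_self,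
      inv_eq_of_mul_eq_one_right R2_mul_self]
  have step : ∀ (g : Γ), ∀ x ∈ ({R0, R1, R2} : Set Γ),
      (g ∈ Subgroup.closure (Set.range parentGens) ∨
        g * R0 ∈ Subgroup.closure (Set.range parentGens)) →
      (g * x ∈ Subgroup.closure (Set.range parentGens) ∨
        g * x * R0 ∈ Subgroup.closure (Set.range parentGens)) := by
    rintro g x (rfl | rfl | rfl) (h | h)
    · right; rwa [mul_assoc, R0_mul_self, mul_one]
    · left; exact h
    · left; exact mul_mem h h1
    · right
      have := mul_mem h h01
      rwa [show g * R0 * (R0 * R1 * R0) = g * (R0 * R0) * R1 * R0 by group, R0_mul_self,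
        mul_one] at this
    · left; exact mul_mem h h2
    · right
      have := mul_mem h h2
      rwa [mul_assoc, R0_mul_R2, ← mul_assoc] at this
  have hg : g ∈ Subgroup.closure {R0, R1, R2} := closure_R0_R1_R2 ▸ Subgroup.mem_top g
  induction hg using Subgroup.closure_induction_right with
  | one => exact Or.inl (one_mem _)
  | mul_right g _ x hx ih => exact step g x hx ih
  | mul_inv_cancel g _ x hx ih => rw [hinv x hx]; exact step g x hx ih

theorem index_closure_parentGens : (Subgroup.closure (Set.range parentGens)).index = 2 := by
  rw [Subgroup.index_eq_two_iff]
  refine ⟨R0, fun g => ?_⟩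
  have hnot : ¬(g * R0 ∈ Subgroup.closure (Set.range parentGens) ∧
      g ∈ Subgroup.closure (Set.range parentGens)) := by
    rintro ⟨h0, h⟩
    have h' := right_toSwapProduct_of_mem h0
    rw [map_mul, SemidirectProduct.mul_right, right_toSwapProduct_of_mem h, toSwapProduct_R0,
      SemidirectProduct.right_inr, one_mul] at h'
    revert h'
    decide
  have := mem_or_mul_R0_mem g
  unfold Xor
  tauto

/-- With `S1 = R1`, `S2 = R0·R1·R0`, `S3 = R2`, each `Si` has order 2, the canonical
homomorphism `(ℤ/2ℤ) ∗ (ℤ/2ℤ) ∗ (ℤ/2ℤ) → Γ` sending the generator of the `i`-th free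
factor to `Si` is injective, and its image, the subgroup generated by `S1, S2, S3`,
has index 2 in `Γ`.  (This is the parent group `N(2)` of Graver–Watkins.) -/
theorem stmt_1 :
    orderOf R1 = 2 ∧ orderOf (R0 * R1 * R0) = 2 ∧ orderOf R2 = 2 ∧
    (∃ φ : Monoid.CoprodI (fun _ : Fin 3 => Multiplicative (ZMod 2)) →* Γ,
      φ (Monoid.CoprodI.of (i := 0) (Multiplicative.ofAdd (1 : ZMod 2))) = R1 ∧
      φ (Monoid.CoprodI.of (i := 1) (Multiplicative.ofAdd (1 : ZMod 2))) = R0 * R1 * R0 ∧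
      φ (Monoid.CoprodI.of (i := 2) (Multiplicative.ofAdd (1 : ZMod 2))) = R2 ∧
      Function.Injective φ ∧
      φ.range = Subgroup.closure {R1, R0 * R1 * R0, R2}) ∧
    (Subgroup.closure {R1, R0 * R1 * R0, R2} : Subgroup Γ).index = 2 := by
  rw [← range_parentGens]
  exact ⟨orderOf_parentGens 0, orderOf_parentGens 1, orderOf_parentGens 2,
    ⟨lift parentGens parentGens_mul_self, lift_gen _ _ 0, lift_gen _ _ 1, lift_gen _ _ 2,
      lift_parentGens_injective, range_lift _ _⟩, index_closure_parentGens⟩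
end

section
/- Let Γ be the free product (ℤ/2ℤ × ℤ/2ℤ) * (ℤ/2ℤ), with R0 and R2 the images of (1,0) and (0,1) from the first free factor and R1 the image of the generator of the second free factor. Set S0 = R1, S1 = R0·R1·R0, S2 = R2·R1·R2, S3 = R0·R2·R1·R2·R0. Then each Si has order 2, the canonical homomorphism from the free product (ℤ/2ℤ) * (ℤ/2ℤ) * (ℤ/2ℤ) * (ℤ/2ℤ) to Γ sending the generator of the i-th free factor to Si is injective, and its image (the subgroup of Γ generated by S0, S1, S2, S3) has index 4 in Γ. -/
namespace Monoid

namespace CoprodI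

variable {ι H : Type*} [Group H]

/-- The endomorphism of a free product of copies of one group that relabels the factors along a
permutation of the index set. -/
def relabel (σ : Equiv.Perm ι) :
    CoprodI (fun _ : ι => H) →* CoprodI (fun _ : ι => H) :=
  lift fun i => of (M := fun _ : ι => H) (i := σ i)

theorem relabel_of (σ : Equiv.Perm ι) (i : ι) (h : H) :
    relabel σ (of (M := fun _ : ι => H) (i := i) h) =
      of (M := fun _ : ι => H) (i := σ i) h :=
  lift_of (M := fun _ : ι => H) (fun i => of (M := fun _ : ι => H) (i := σ i)) h

theorem relabel_mul (σ τ : Equiv.Perm ι) :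
    relabel (H := H) (σ * τ) = (relabel σ).comp (relabel τ) := by
  refine ext_hom _ _ fun i => MonoidHom.ext fun h => ?_
  simp only [MonoidHom.comp_apply]
  rw [relabel_of, relabel_of, relabel_of, Equiv.Perm.mul_apply]

theorem relabel_one : relabel (1 : Equiv.Perm ι) = MonoidHom.id (CoprodI fun _ : ι => H) :=
  ext_hom _ _ fun i => MonoidHom.ext fun h => relabel_of 1 i h

/-- The action of the permutations of the index set on a free product of copies of one group. -/
def relabelAut : Equiv.Perm ι →* MulAut (CoprodI fun _ : ι => H) where
  toFun σ := (relabel σ).toMulEquiv (relabel σ⁻¹)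
    (by rw [← relabel_mul, inv_mul_cancel, relabel_one])
    (by rw [← relabel_mul, mul_inv_cancel, relabel_one])
  map_one' := MulEquiv.ext fun x => DFunLike.congr_fun relabel_one x
  map_mul' σ τ := MulEquiv.ext fun x => DFunLike.congr_fun (relabel_mul σ τ) x

theorem relabelAut_of (σ : Equiv.Perm ι) (i : ι) (h : H) :
    relabelAut σ (of (M := fun _ : ι => H) (i := i) h) =
      of (M := fun _ : ι => H) (i := σ i) h :=
  relabel_of σ i h

end CoprodI

namespace Coprod

variable {ι V H : Type*} [Group V] [Group H]

/-- The homomorphism to `V ∗ H` from a free product of copies of `H`, indexed by `V` through `e`,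
that sends the factor of index `i` to the conjugate of `H` by `e i`. -/
def conjLift (H : Type*) [Group H] (e : ι ≃ V) :
    CoprodI (fun _ : ι => H) →* Coprod V H :=
  CoprodI.lift fun i => (MulAut.conj (inl (e i) : Coprod V H)).toMonoidHom.comp inr

theorem conjLift_of (e : ι ≃ V) (i : ι) (h : H) :
    conjLift H e (CoprodI.of (M := fun _ : ι => H) (i := i) h) =
      inl (e i) * inr h * (inl (e i))⁻¹ :=
  CoprodI.lift_of (M := fun _ : ι => H)
    (fun i => (MulAut.conj (inl (e i) : Coprod V H)).toMonoidHom.comp inr) h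

theorem conjLift_injective (e : ι ≃ V) : Function.Injective (conjLift H e) := by
  let θ : V →* MulAut (CoprodI fun _ : ι => H) :=
    (CoprodI.relabelAut.comp e.symm.permCongrHom.toMonoidHom).comp (MulAction.toPermHom V V)
  let ψ : Coprod V H →* (CoprodI fun _ : ι => H) ⋊[θ] V :=
    lift SemidirectProduct.inr
      (SemidirectProduct.inl.comp (CoprodI.of (M := fun _ : ι => H) (i := e.symm 1)))
  have hψ : ψ.comp (conjLift H e) = SemidirectProduct.inl := by
    refine CoprodI.ext_hom _ _ fun i => MonoidHom.ext fun h => ?_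
    have hθ : θ (e i) (CoprodI.of (M := fun _ : ι => H) (i := e.symm 1) h) =
        CoprodI.of (M := fun _ : ι => H) (i := i) h := by
      refine (CoprodI.relabelAut_of _ _ h).trans ?_
      have hi : e.symm.permCongrHom.toMonoidHom (MulAction.toPermHom V V (e i)) (e.symm 1) = i := by
        simp [Equiv.permCongrHom]
      rw [hi]
    simp only [MonoidHom.comp_apply]
    rw [conjLift_of, map_mul, map_mul, map_inv, lift_apply_inl, lift_apply_inr, ← map_inv,
      MonoidHom.comp_apply, ← SemidirectProduct.inl_aut, hθ]
  refine Function.Injective.of_comp (f := ψ) ?_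
  rw [← MonoidHom.coe_comp, hψ]
  exact SemidirectProduct.inl_injective

theorem conj_inl_mem_range_conjLift (e : ι ≃ V) (v : V) {x : Coprod V H}
    (hx : x ∈ (conjLift H e).range) : inl v * x * (inl v)⁻¹ ∈ (conjLift H e).range := by
  suffices (conjLift H e).range ≤
      (conjLift H e).range.comap (MulAut.conj (inl v : Coprod V H)).toMonoidHom from this hx
  refine CoprodI.lift_range_le (G := fun _ : ι => H) _ fun i => ?_
  rintro _ ⟨h, rfl⟩
  refine ⟨CoprodI.of (M := fun _ : ι => H) (i := e.symm (v * e i)) h, ?_⟩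
  rw [conjLift_of]
  simp [mul_assoc]

theorem range_conjLift (e : ι ≃ V) :
    (conjLift H e).range = (fst : Coprod V H →* V).ker := by
  apply le_antisymm
  · refine CoprodI.lift_range_le (G := fun _ : ι => H) _ fun i => ?_
    rintro _ ⟨h, rfl⟩
    simp [MonoidHom.mem_ker]
  · have key (g : Coprod V H) : g * (inl (fst g))⁻¹ ∈ (conjLift H e).range := by
      induction g using Coprod.induction_on with
      | inl v => simp
      | inr h =>
        refine ⟨CoprodI.of (M := fun _ : ι => H) (i := e.symm 1) h, ?_⟩
        rw [conjLift_of]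
        simp
      | mul x y hx hy =>
        have := mul_mem hx (conj_inl_mem_range_conjLift e (fst x) hy)
        simpa [mul_assoc] using this
    intro g hg
    simpa [MonoidHom.mem_ker.mp hg] using key g

theorem index_range_conjLift (e : ι ≃ V) : (conjLift H e).range.index = Nat.card V := by
  rw [range_conjLift, Subgroup.index_ker, MonoidHom.range_eq_top_of_surjective _ fst_surjective,
    Subgroup.card_top]

end Coprod

end Monoid

theorem inv_R0 : R0⁻¹ = R0 := rfl

theorem inv_R2 : R2⁻¹ = R2 := rfl

/-- The elements of the Klein four-group in the order `1, R0, R2, R0 * R2`. -/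
def kleinEquiv : Fin 4 ≃ Multiplicative (ZMod 2 × ZMod 2) where
  toFun := ![.ofAdd (0, 0), .ofAdd (1, 0), .ofAdd (0, 1), .ofAdd (1, 1)]
  invFun v := if v.toAdd.1 = 0 then (if v.toAdd.2 = 0 then 0 else 2)
    else (if v.toAdd.2 = 0 then 1 else 3)
  left_inv := by decide
  right_inv := by decide

theorem inl_one_one : (Monoid.Coprod.inl (Multiplicative.ofAdd ((1, 1) : ZMod 2 × ZMod 2)) : Γ) =
    R0 * R2 :=
  map_mul Monoid.Coprod.inl (Multiplicative.ofAdd ((1, 0) : ZMod 2 × ZMod 2))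
    (Multiplicative.ofAdd (0, 1))

/-- With `S0 = R1`, `S1 = R0·R1·R0`, `S2 = R2·R1·R2`, `S3 = R0·R2·R1·R2·R0`, each `Si` has
order 2, the canonical homomorphism `(ℤ/2ℤ) ∗ (ℤ/2ℤ) ∗ (ℤ/2ℤ) ∗ (ℤ/2ℤ) → Γ` sending the
generator of the `i`-th free factor to `Si` is injective, and its image, the subgroup
generated by `S0, S1, S2, S3`, has index 4 in `Γ`.
(This is the parent group `N(3)` of Graver–Watkins.) -/
theorem stmt_3 :
    orderOf R1 = 2 ∧ orderOf (R0 * R1 * R0) = 2 ∧ orderOf (R2 * R1 * R2) = 2 ∧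
    orderOf (R0 * R2 * R1 * R2 * R0) = 2 ∧
    (∃ φ : Monoid.CoprodI (fun _ : Fin 4 => Multiplicative (ZMod 2)) →* Γ,
      φ (Monoid.CoprodI.of (i := 0) (Multiplicative.ofAdd (1 : ZMod 2))) = R1 ∧
      φ (Monoid.CoprodI.of (i := 1) (Multiplicative.ofAdd (1 : ZMod 2))) = R0 * R1 * R0 ∧
      φ (Monoid.CoprodI.of (i := 2) (Multiplicative.ofAdd (1 : ZMod 2))) = R2 * R1 * R2 ∧
      φ (Monoid.CoprodI.of (i := 3) (Multiplicative.ofAdd (1 : ZMod 2))) = R0 * R2 * R1 * R2 * R0 ∧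
      Function.Injective φ ∧
      φ.range = Subgroup.closure {R1, R0 * R1 * R0, R2 * R1 * R2, R0 * R2 * R1 * R2 * R0}) ∧
    (Subgroup.closure {R1, R0 * R1 * R0, R2 * R1 * R2, R0 * R2 * R1 * R2 * R0} :
      Subgroup Γ).index = 4 := by
  let φ := Monoid.Coprod.conjLift (Multiplicative (ZMod 2)) kleinEquiv
  have hφ : Function.Injective φ := Monoid.Coprod.conjLift_injective kleinEquiv
  let t : Multiplicative (ZMod 2) := .ofAdd 1
  let s (i : Fin 4) : Monoid.CoprodI fun _ : Fin 4 => Multiplicative (ZMod 2) :=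
    Monoid.CoprodI.of (i := i) t
  have h0 : φ (s 0) = R1 := by
    refine (Monoid.Coprod.conjLift_of kleinEquiv 0 t).trans ?_
    change Monoid.Coprod.inl 1 * R1 * (Monoid.Coprod.inl 1)⁻¹ = R1
    simp
  have h1 : φ (s 1) = R0 * R1 * R0 := by
    refine (Monoid.Coprod.conjLift_of kleinEquiv 1 t).trans ?_
    change R0 * R1 * R0⁻¹ = _
    rw [inv_R0]
  have h2 : φ (s 2) = R2 * R1 * R2 := by
    refine (Monoid.Coprod.conjLift_of kleinEquiv 2 t).trans ?_
    change R2 * R1 * R2⁻¹ = _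
    rw [inv_R2]
  have h3 : φ (s 3) = R0 * R2 * R1 * R2 * R0 := by
    refine (Monoid.Coprod.conjLift_of kleinEquiv 3 t).trans ?_
    change Monoid.Coprod.inl (Multiplicative.ofAdd ((1, 1) : ZMod 2 × ZMod 2)) * R1 *
      (Monoid.Coprod.inl (Multiplicative.ofAdd ((1, 1) : ZMod 2 × ZMod 2)))⁻¹ = _
    rw [inl_one_one, mul_inv_rev, inv_R0, inv_R2]
    simp only [mul_assoc]
  have ht : orderOf t = 2 := orderOf_eq_prime (by decide) (by decide)
  have hord (i : Fin 4) : orderOf (φ (s i)) = 2 := by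
    rw [orderOf_injective φ hφ]
    refine (orderOf_injective
      (Monoid.CoprodI.of (M := fun _ : Fin 4 => Multiplicative (ZMod 2)) (i := i))
      (Monoid.CoprodI.of_injective i) t).trans ht
  have hrange : φ.range =
      Subgroup.closure {R1, R0 * R1 * R0, R2 * R1 * R2, R0 * R2 * R1 * R2 * R0} := by
    apply le_antisymm
    · have hs (i : Fin 4) : φ (s i) ∈
          Subgroup.closure {R1, R0 * R1 * R0, R2 * R1 * R2, R0 * R2 * R1 * R2 * R0} := by
        apply Subgroup.subset_closure
        fin_cases i
        · exact .inl h0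
        · exact .inr (.inl h1)
        · exact .inr (.inr (.inl h2))
        · exact .inr (.inr (.inr h3))
      refine Monoid.CoprodI.lift_range_le (G := fun _ : Fin 4 => Multiplicative (ZMod 2)) _ fun i => ?_
      rintro _ ⟨x, rfl⟩
      obtain rfl | rfl : x = 1 ∨ x = t := by revert x; decide
      · rw [map_one]
        exact one_mem _
      · have := hs i
        rwa [show φ (s i) = _ from Monoid.Coprod.conjLift_of kleinEquiv i t] at this
    · rw [Subgroup.closure_le]
      rintro _ (rfl | rfl | rfl | rfl)
      exacts [⟨_, h0⟩, ⟨_, h1⟩, ⟨_, h2⟩, ⟨_, h3⟩]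
  refine ⟨h0 ▸ hord 0, h1 ▸ hord 1, h2 ▸ hord 2, h3 ▸ hord 3,
    ⟨φ, h0, h1, h2, h3, hφ, hrange⟩, ?_⟩
  rw [← hrange, Monoid.Coprod.index_range_conjLift]
  simp
end

section
/- Let G be a cyclic group acting on a finite set X, and suppose the induced action of G on the 2-element subsets of X is transitive (for any two 2-element subsets P, Q of X there exists g ∈ G with g·P = Q). Then X has at most 3 elements. -/
/-- If any two distinct points can be moved, as an unordered pair, to any other pair, then an
action on a set with at least three points is transitive. -/
theorem exists_smul_eq_of_pairs {G X : Type*} [Group G] [MulAction G X]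
    (h : ∀ a b c d : X, a ≠ b → c ≠ d →
      ∃ g : G, (g • a = c ∧ g • b = d) ∨ (g • a = d ∧ g • b = c))
    {x y z : X} (hxz : x ≠ z) (hyz : y ≠ z) : ∃ g : G, g • x = y := by
  obtain ⟨g, ⟨hx, -⟩ | ⟨hx, hz⟩⟩ := h x z y z hxz hyz
  · exact ⟨g, hx⟩
  · exact ⟨g * g, by rw [mul_smul, hx, hz]⟩

/-- If `k` commutes with an element carrying `x` to `y` and fixes `x`, then it fixes `y`. -/
theorem smul_eq_self_of_commute {G X : Type*} [Monoid G] [MulAction G X] {k g : G} {x y : X}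
    (hc : Commute k g) (hg : g • x = y) (hk : k • x = x) : k • y = y := by
  rw [← hg, ← mul_smul, hc.eq, mul_smul, hk]

/-- If a cyclic group `G` acts on a finite set `X` so that the induced action on
2-element subsets is transitive (i.e. `G` is 2-homogeneous on `X`), then `X` has at
most 3 elements. -/
theorem stmt_6 (G X : Type*) [Group G] [IsCyclic G] [Fintype X] [DecidableEq X]
    [MulAction G X]
    (h : ∀ P Q : Finset X, P.card = 2 → Q.card = 2 →
      ∃ g : G, P.image (fun x => g • x) = Q) :
    Fintype.card X ≤ 3 := by
  have hcomm (a b : G) : Commute a b := IsCyclic.commGroup.mul_comm a b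
  have hpair (a b c d : X) (hab : a ≠ b) (hcd : c ≠ d) :
      ∃ g : G, (g • a = c ∧ g • b = d) ∨ (g • a = d ∧ g • b = c) := by
    obtain ⟨g, hg⟩ := h {a, b} {c, d} (Finset.card_pair hab) (Finset.card_pair hcd)
    refine ⟨g, ?_⟩
    have hs := congrArg (fun s : Finset X => (s : Set X)) hg
    simp only [Finset.image_insert, Finset.image_singleton, Finset.coe_pair] at hs
    exact Set.pair_eq_pair_iff.mp hs
  by_contra! hcard
  obtain ⟨e⟩ := Function.Embedding.nonempty_of_card_le (α := Fin 4) (β := X)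
    (by simpa using Nat.succ_le_of_lt hcard)
  have hne {i j : Fin 4} (hij : i ≠ j) : e i ≠ e j := e.injective.ne hij
  have htrans : ∃ t : G, t • e 0 = e 1 :=
    exists_smul_eq_of_pairs hpair (z := e 2) (hne (by decide)) (hne (by decide))
  obtain ⟨t, ht⟩ := htrans
  have ht' : t⁻¹ • e 1 = e 0 := by rw [← ht, inv_smul_smul]
  have hswap {i : Fin 4} (h0 : 0 ≠ i) (h1 : 1 ≠ i) :
      ∃ g : G, g • e 0 = e i ∧ g • e 1 = e 0 := by
    obtain ⟨g, ⟨hg0, hg1⟩ | hg⟩ := hpair (e 0) (e 1) (e 0) (e i) (hne (by decide)) (hne h0)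
    · exact absurd ((smul_eq_self_of_commute (hcomm g t) ht hg0).symm.trans hg1) (hne h1)
    · exact ⟨g, hg⟩
  obtain ⟨g, hg0, hg1⟩ := hswap (i := 2) (by decide) (by decide)
  obtain ⟨k, hk0, hk1⟩ := hswap (i := 3) (by decide) (by decide)
  have hfix : (g⁻¹ * k) • e 1 = e 1 := by rw [mul_smul, hk1, ← hg1, inv_smul_smul]
  have hfix' := smul_eq_self_of_commute (hcomm _ t⁻¹) ht' hfix
  rw [mul_smul, inv_smul_eq_iff, hk0, hg0] at hfix'
  exact hne (by decide) hfix'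
end

section
/- Let G be a finite group of even order acting faithfully on a finite set X with at least 2 elements, and suppose the induced action of G on the 2-element subsets of X is transitive. Then the action of G on X is 2-transitive: for any ordered pairs (a,b) and (c,d) with a ≠ b and c ≠ d there exists g ∈ G with g·a = c and g·b = d. -/
/-- A 2-homogeneous action moves any pair of distinct points to any other, up to order. -/
theorem exists_smul_pair_eq_or_swap {G X : Type*} [Group G] [DecidableEq X] [MulAction G X]
    (h : ∀ P Q : Finset X, P.card = 2 → Q.card = 2 →
      ∃ g : G, P.image (fun x => g • x) = Q)
    {a b c d : X} (hab : a ≠ b) (hcd : c ≠ d) :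
    ∃ g : G, (g • a = c ∧ g • b = d) ∨ (g • a = d ∧ g • b = c) := by
  obtain ⟨g, hg⟩ := h {a, b} {c, d} (Finset.card_pair hab) (Finset.card_pair hcd)
  refine ⟨g, Set.pair_eq_pair_iff.mp ?_⟩
  rw [Finset.image_insert, Finset.image_singleton] at hg
  rw [← Finset.coe_pair, ← Finset.coe_pair, hg]

/-- A group of even order acting faithfully contains an element swapping two distinct points. -/
theorem exists_smul_swap_of_even_card {G X : Type*} [Group G] [Fintype G] [MulAction G X]
    [FaithfulSMul G X] (heven : Even (Fintype.card G)) :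
    ∃ (t : G) (x y : X), x ≠ y ∧ t • x = y ∧ t • y = x := by
  obtain ⟨t, ht⟩ := exists_prime_orderOf_dvd_card 2 heven.two_dvd
  have htt : t * t = 1 := by rw [← pow_two, ← ht, pow_orderOf_eq_one]
  have hx : ∃ x : X, t • x ≠ x := by
    by_contra! hfix
    have ht1 : t = 1 := FaithfulSMul.eq_of_smul_eq_smul (α := X) fun x => by
      rw [hfix x, one_smul]
    simp [ht1] at ht
  obtain ⟨x, hx⟩ := hx
  exact ⟨t, x, t • x, hx.symm, rfl, by rw [smul_smul, htt, one_smul]⟩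

/-- If a finite group `G` of even order acts faithfully on a finite set `X` with at least
2 elements, and the induced action on 2-element subsets is transitive (i.e. `G` is
2-homogeneous on `X`), then the action of `G` on `X` is 2-transitive. -/
theorem stmt_7 (G X : Type*) [Group G] [Fintype G] [Fintype X] [DecidableEq X]
    [MulAction G X] [FaithfulSMul G X]
    (heven : Even (Fintype.card G)) (hX : 2 ≤ Fintype.card X)
    (h : ∀ P Q : Finset X, P.card = 2 → Q.card = 2 →
      ∃ g : G, P.image (fun x => g • x) = Q) :
    ∀ a b c d : X, a ≠ b → c ≠ d → ∃ g : G, g • a = c ∧ g • b = d := by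
  intro a b c d hab hcd
  obtain ⟨t, x, y, hxy, htx, hty⟩ := exists_smul_swap_of_even_card (X := X) heven
  obtain ⟨g, hg⟩ := exists_smul_pair_eq_or_swap h hab hxy
  obtain ⟨k, hk⟩ := exists_smul_pair_eq_or_swap h hxy hcd
  rcases hg with ⟨hga, hgb⟩ | ⟨hga, hgb⟩ <;> rcases hk with ⟨hkx, hky⟩ | ⟨hkx, hky⟩
  · exact ⟨k * g, by simp [mul_smul, *], by simp [mul_smul, *]⟩
  · exact ⟨k * t * g, by simp [mul_smul, *], by simp [mul_smul, *]⟩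
  · exact ⟨k * t * g, by simp [mul_smul, *], by simp [mul_smul, *]⟩
  · exact ⟨k * g, by simp [mul_smul, *], by simp [mul_smul, *]⟩
end

section
/- Let F be a finite field of odd cardinality q ≥ 3, and let AGL1(F) denote the group (under composition) of affine permutations of F, i.e., maps of the form x ↦ a·x + b with a ∈ Fˣ and b ∈ F. Then AGL1(F) has exactly one subgroup of index 2, namely AHL1(F) = { x ↦ a·x + b : a is a nonzero square in F, b ∈ F }. -/
namespace AffineLine

variable {F : Type*} [Field F]

/-- The affine permutation `x ↦ u * x + b`. -/
def ofCoeffs (u : Fˣ) (b : F) : F ≃ᵃ[F] F :=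
  (LinearEquiv.smulOfUnit u).toAffineEquiv.trans (AffineEquiv.constVAdd F F b)

@[simp]
lemma ofCoeffs_apply (u : Fˣ) (b x : F) : ofCoeffs u b x = u * x + b := by
  simp [ofCoeffs, LinearEquiv.smulOfUnit, Units.smul_def, add_comm]

/-- The slope `a` of the affine permutation `x ↦ a * x + b`. -/
def slope : (F ≃ᵃ[F] F) →* F where
  toFun f := f.linear 1
  map_one' := rfl
  map_mul' f g := by
    change f.linear (g.linear 1) = _
    rw [← mul_one (g.linear 1), ← smul_eq_mul, map_smul, smul_eq_mul, smul_eq_mul, mul_one,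
      mul_comm]

lemma apply_eq (f : F ≃ᵃ[F] F) (x : F) : f x = slope f * x + f 0 := by
  have h := f.map_vadd 0 x
  have h' : f.linear x = x * f.linear 1 := by
    rw [← smul_eq_mul, ← map_smul, smul_eq_mul, mul_one]
  simp only [vadd_eq_add, add_zero] at h
  rw [h, h', mul_comm]
  rfl

lemma slope_eq {f : F ≃ᵃ[F] F} {a b : F} (h : ∀ x, f x = a * x + b) : slope f = a := by
  have h1 := apply_eq f 1
  simp only [h] at h1
  linear_combination -h1

lemma slope_ne_zero (f : F ≃ᵃ[F] F) : slope f ≠ 0 :=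
  (slope.toHomUnits f).ne_zero

@[simp]
lemma slope_ofCoeffs (u : Fˣ) (b : F) : slope (ofCoeffs u b) = u :=
  slope_eq (ofCoeffs_apply u b)

variable (F) in
/-- The affine permutations whose slope is a square. -/
def squareSlope : Subgroup (F ≃ᵃ[F] F) where
  carrier := {f | IsSquare (slope f)}
  one_mem' := by simp
  mul_mem' {f g} hf hg := by
    simp only [Set.mem_ofPred_eq, map_mul] at *
    exact hf.mul hg
  inv_mem' {f} hf := by
    have h : slope f * slope f⁻¹ = 1 := by rw [← map_mul, mul_inv_cancel, map_one]
    rw [Set.mem_ofPred_eq, eq_inv_of_mul_eq_one_right h]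
    exact IsSquare.inv hf

lemma mem_squareSlope {f : F ≃ᵃ[F] F} : f ∈ squareSlope F ↔ IsSquare (slope f) := Iff.rfl

lemma coe_squareSlope : (squareSlope F : Set (F ≃ᵃ[F] F)) =
    {f | ∃ a b : F, IsSquare a ∧ a ≠ 0 ∧ ∀ x : F, f x = a * x + b} := by
  ext f
  constructor
  · exact fun hf ↦ ⟨slope f, f 0, hf, slope_ne_zero f, apply_eq f⟩
  · rintro ⟨a, b, ha, -, h⟩
    rw [SetLike.mem_coe, mem_squareSlope, slope_eq h]
    exact ha

lemma squareSlope_le_of_index_eq_two (h2 : (2 : F) ≠ 0) {H : Subgroup (F ≃ᵃ[F] F)}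
    (hH : H.index = 2) : squareSlope F ≤ H := by
  intro f hf
  obtain ⟨c, hc⟩ := mem_squareSlope.1 hf
  have hc0 : c ≠ 0 := by
    rintro rfl
    exact slope_ne_zero f (by simpa using hc)
  have key : f = ofCoeffs 1 (f 0 / 2) ^ 2 * ofCoeffs (Units.mk0 c hc0) 0 ^ 2 := by
    ext x
    rw [apply_eq f x, hc]
    simp only [pow_two, AffineEquiv.mul_def, AffineEquiv.trans_apply, ofCoeffs_apply,
      Units.val_one, Units.val_mk0]
    field_simp
    ring
  rw [key]
  exact H.mul_mem (Subgroup.sq_mem_of_index_two hH _) (Subgroup.sq_mem_of_index_two hH _)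

lemma index_squareSlope [Finite F] (hF : ringChar F ≠ 2) : (squareSlope F).index = 2 := by
  classical
  have := Fintype.ofFinite F
  obtain ⟨a, ha⟩ := FiniteField.exists_nonsquare hF
  have ha0 : a ≠ 0 := by
    rintro rfl
    exact ha IsSquare.zero
  rw [Subgroup.index_eq_two_iff]
  refine ⟨ofCoeffs (Units.mk0 a ha0) 0, fun f ↦ ?_⟩
  have hf := slope_ne_zero f
  simp only [mem_squareSlope, map_mul, slope_ofCoeffs, Units.val_mk0]
  have hχa := quadraticChar_neg_one_iff_not_isSquare.2 ha
  rw [← quadraticChar_one_iff_isSquare hf, ← quadraticChar_one_iff_isSquare (mul_ne_zero hf ha0),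
    map_mul, hχa]
  rcases quadraticChar_dichotomy hf with h | h <;> simp [h]

lemma index_eq_two_iff [Finite F] (hF : ringChar F ≠ 2) {H : Subgroup (F ≃ᵃ[F] F)} :
    H.index = 2 ↔ H = squareSlope F := by
  refine ⟨fun hH ↦ ?_, fun hH ↦ hH ▸ index_squareSlope hF⟩
  have hle := squareSlope_le_of_index_eq_two (Ring.two_ne_zero hF) hH
  have hmul := Subgroup.relIndex_mul_index hle
  rw [hH, index_squareSlope hF] at hmul
  exact le_antisymm (Subgroup.relIndex_eq_one.1 (by omega)) hle

end AffineLine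


/-- Let `F` be a finite field of odd cardinality `q ≥ 3`, and let `AGL₁(F) = F ≃ᵃ[F] F`
be the group of affine permutations `x ↦ a·x + b` (`a ≠ 0`) of `F`.  Then `AGL₁(F)` has
exactly one subgroup of index 2, namely
`AHL₁(F) = { x ↦ a·x + b : a a nonzero square in F }`. -/
theorem stmt_12 (F : Type*) [Field F] [Fintype F]
    (hodd : Odd (Fintype.card F)) (h3 : 3 ≤ Fintype.card F) :
    (∃ H : Subgroup (F ≃ᵃ[F] F),
      (H : Set (F ≃ᵃ[F] F)) =
        {f : F ≃ᵃ[F] F | ∃ a b : F, IsSquare a ∧ a ≠ 0 ∧ ∀ x : F, f x = a * x + b}) ∧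
    (∀ H : Subgroup (F ≃ᵃ[F] F), H.index = 2 ↔
      (H : Set (F ≃ᵃ[F] F)) =
        {f : F ≃ᵃ[F] F | ∃ a b : F, IsSquare a ∧ a ≠ 0 ∧ ∀ x : F, f x = a * x + b}) := by
  have hF : ringChar F ≠ 2 := fun h ↦
    Nat.not_even_iff_odd.2 hodd (Nat.even_iff.2 (FiniteField.even_card_iff_char_two.1 h))
  refine ⟨⟨AffineLine.squareSlope F, AffineLine.coe_squareSlope⟩, fun H ↦ ?_⟩
  rw [AffineLine.index_eq_two_iff hF, ← AffineLine.coe_squareSlope, SetLike.coe_set_eq]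
end

section
/- Let G be a finite group acting sharply 2-transitively on a finite set X with |X| ≥ 4; that is, for any ordered pairs (a,b) and (c,d) of elements of X with a ≠ b and c ≠ d there is exactly one g ∈ G with g·a = c and g·b = d. Suppose the stabilizer in G of each point of X is cyclic. Then G is not generated by involutions (elements of order 2). -/
/-- If a group is generated by involutions, then every normal subgroup with commutative quotient
contains all squares. -/
theorem sq_mem_of_closure_involutions {G : Type*} [Group G] (K : Subgroup G) [K.Normal]
    (hcomm : ∀ a b : G ⧸ K, a * b = b * a)
    (hgen : Subgroup.closure {g : G | orderOf g = 2} = ⊤) (g : G) : g ^ 2 ∈ K := by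
  have hg : g ∈ Subgroup.closure {g : G | orderOf g = 2} := hgen ▸ Subgroup.mem_top g
  rw [← QuotientGroup.eq_one_iff, QuotientGroup.mk_pow]
  induction hg using Subgroup.closure_induction with
  | mem x hx =>
    rw [← QuotientGroup.mk_pow, ← (show orderOf x = 2 from hx), pow_orderOf_eq_one,
      QuotientGroup.mk_one]
  | one => simp
  | mul x y _ _ hx hy =>
    rw [QuotientGroup.mk_mul, Commute.mul_pow (hcomm _ _), hx, hy, one_mul]
  | inv x _ hx => rw [QuotientGroup.mk_inv, inv_pow, hx, inv_one]

namespace SharplyTwoTransitive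

variable {G X : Type*} [Group G] [MulAction G X]

theorem eq_one_of_fixes_two
    (hsharp : ∀ a b c d : X, a ≠ b → c ≠ d → ∃! g : G, g • a = c ∧ g • b = d)
    {g : G} {a b : X} (hab : a ≠ b) (ha : g • a = a) (hb : g • b = b) : g = 1 :=
  (hsharp a b a b hab hab).unique ⟨ha, hb⟩ ⟨one_smul _ _, one_smul _ _⟩

theorem eq_one_of_commute_derangement
    (hsharp : ∀ a b c d : X, a ≠ b → c ≠ d → ∃! g : G, g • a = c ∧ g • b = d)
    {t g : G} (ht : ∀ x : X, t • x ≠ x) (hgt : g * t = t * g) {x : X} (hx : g • x = x) :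
    g = 1 :=
  eq_one_of_fixes_two hsharp (ht x).symm hx (by rw [← mul_smul, hgt, mul_smul, hx])

theorem card_group [Fintype X]
    (hsharp : ∀ a b c d : X, a ≠ b → c ≠ d → ∃! g : G, g • a = c ∧ g • b = d)
    {a b : X} (hab : a ≠ b) :
    Nat.card G = Fintype.card X * (Fintype.card X - 1) := by
  classical
  have hbij : Function.Bijective (fun g : G =>
      (⟨(g • a, g • b), by simpa using hab⟩ :
        {p : X × X // p ∈ (Finset.univ : Finset X).offDiag})) := by
    refine ⟨fun g h hgh => ?_, fun ⟨⟨c, d⟩, hcd⟩ => ?_⟩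
    · simp only [Subtype.mk.injEq, Prod.mk.injEq] at hgh
      exact (hsharp a b (h • a) (h • b) hab (by simpa using hab)).unique hgh ⟨rfl, rfl⟩
    · obtain ⟨g, hg, -⟩ := hsharp a b c d hab (by simpa using hcd)
      exact ⟨g, by simp [hg.1, hg.2]⟩
  rw [Nat.card_congr (Equiv.ofBijective _ hbij), Nat.card_eq_fintype_card, Fintype.card_coe,
    Finset.offDiag_card, Finset.card_univ, Nat.mul_sub_one]

theorem card_stabilizer [Fintype X]
    (hsharp : ∀ a b c d : X, a ≠ b → c ≠ d → ∃! g : G, g • a = c ∧ g • b = d)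
    {a b : X} (hab : a ≠ b) :
    Nat.card (MulAction.stabilizer G a) = Fintype.card X - 1 := by
  classical
  have hbij : Function.Bijective (fun g : MulAction.stabilizer G a =>
      (⟨(g : G) • b, fun h => hab (by
        have hg : (g : G) • a = a := g.2
        rw [← smul_left_cancel_iff (g : G), hg, h])⟩ : {y : X // y ≠ a})) := by
    refine ⟨fun g h hgh => ?_, fun ⟨c, hc⟩ => ?_⟩
    · have hgh' : (g : G) • b = (h : G) • b := congrArg Subtype.val hgh
      refine Subtype.ext ((hsharp a b a ((h : G) • b) hab ?_).unique ⟨g.2, hgh'⟩ ⟨h.2, rfl⟩)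
      intro e
      have hh : (h : G) • a = a := h.2
      exact hab (by rw [← smul_left_cancel_iff (h : G), hh, ← e])
    · obtain ⟨g, hg, -⟩ := hsharp a b a c hab hc.symm
      exact ⟨⟨g, hg.1⟩, Subtype.ext hg.2⟩
  rw [Nat.card_congr (Equiv.ofBijective _ hbij), Nat.card_eq_fintype_card]
  simp [Fintype.card_subtype_compl]

theorem isPretransitive [Nontrivial X]
    (hsharp : ∀ a b c d : X, a ≠ b → c ≠ d → ∃! g : G, g • a = c ∧ g • b = d) :
    MulAction.IsPretransitive G X :=
  ⟨fun a c => by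
    obtain ⟨b, hb⟩ := exists_ne a
    obtain ⟨d, hd⟩ := exists_ne c
    obtain ⟨g, hg, -⟩ := hsharp a b c d hb.symm hd.symm
    exact ⟨g, hg.1⟩⟩

/-- The number of derangements is `|X| - 1`, by Burnside's lemma. -/
theorem ncard_derangements [Finite G] [Fintype X] [Nontrivial X]
    (hsharp : ∀ a b c d : X, a ≠ b → c ≠ d → ∃! g : G, g • a = c ∧ g • b = d) :
    {t : G | ∀ x : X, t • x ≠ x}.ncard = Fintype.card X - 1 := by
  classical
  have := Fintype.ofFinite G
  have := isPretransitive hsharp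
  have : Unique (Quotient (MulAction.orbitRel G X)) :=
    ⟨⟨Quotient.mk _ (Classical.arbitrary X)⟩, fun q => Subsingleton.elim (h :=
      (MulAction.pretransitive_iff_subsingleton_quotient G X).1 inferInstance) _ _⟩
  have hburn := MulAction.sum_card_fixedBy_eq_card_orbits_mul_card_group G X
  rw [Fintype.card_unique, one_mul] at hburn
  have hterm : ∀ g : G, Fintype.card (MulAction.fixedBy X g) +
      (if ∀ x : X, g • x ≠ x then 1 else 0) =
        1 + (if g = 1 then Fintype.card X - 1 else 0) := by
    intro g
    by_cases h1 : g = 1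
    · subst h1
      have hc : Fintype.card (MulAction.fixedBy X (1 : G)) = Fintype.card X := by
        simp [← Nat.card_eq_fintype_card]
      have := Fintype.card_pos (α := X)
      rw [hc, if_neg (by simp), if_pos rfl]
      lia
    · rw [if_neg h1]
      split_ifs with hd
      · rw [Fintype.card_eq_zero_iff.2 ⟨fun x => hd x.1 x.2⟩]
      · push Not at hd
        obtain ⟨x, hx⟩ := hd
        have : Fintype.card (MulAction.fixedBy X g) = 1 :=
          Fintype.card_eq_one_iff.2 ⟨⟨x, hx⟩, fun y => Subtype.ext (by
            by_contra hyx
            exact h1 (eq_one_of_fixes_two hsharp hyx y.2 hx))⟩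
        rw [this]
  have hsum := Finset.sum_congr (rfl : (Finset.univ : Finset G) = Finset.univ)
    (fun g _ => hterm g)
  rw [Finset.sum_add_distrib, Finset.sum_add_distrib, hburn, Finset.sum_ite_eq' Finset.univ,
    Finset.sum_boole] at hsum
  simp only [Finset.sum_const, Finset.card_univ, smul_eq_mul, mul_one, Finset.mem_univ,
    if_true, Nat.cast_id, add_right_inj] at hsum
  rw [← hsum, Set.ncard_eq_toFinset_card']
  congr 1
  ext
  simp

/-- The centralizer of a derangement consists of the identity and all derangements. -/
theorem coe_centralizer_derangement [Finite G] [Fintype X] [Nontrivial X]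
    (hsharp : ∀ a b c d : X, a ≠ b → c ≠ d → ∃! g : G, g • a = c ∧ g • b = d)
    {t : G} (ht : ∀ x : X, t • x ≠ x) :
    (Subgroup.centralizer {t} : Set G) = insert 1 {s : G | ∀ x : X, s • x ≠ x} ∧
      Nat.card (Subgroup.centralizer {t}) = Fintype.card X := by
  classical
  obtain ⟨a, b, hab⟩ := exists_pair_ne X
  have hpos : 0 < Fintype.card X - 1 := Nat.sub_pos_of_lt Fintype.one_lt_card
  have hD := ncard_derangements hsharp
  have hK : (insert 1 {s : G | ∀ x : X, s • x ≠ x}).ncard = Fintype.card X := by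
    rw [Set.ncard_insert_of_notMem (by simp), hD]
    lia
  have hsub : (Subgroup.centralizer {t} : Set G) ⊆ insert 1 {s : G | ∀ x : X, s • x ≠ x} := by
    intro g hg
    by_contra hn
    simp only [Set.mem_insert_iff, Set.mem_ofPred_eq, not_or, not_forall, not_not] at hn
    obtain ⟨h1, x, hx⟩ := hn
    exact h1 (eq_one_of_commute_derangement hsharp ht
      (Subgroup.mem_centralizer_singleton_iff.1 hg) hx)
  have hclass : (MulAction.orbit (ConjAct G) t).ncard ≤ Fintype.card X - 1 := by
    rw [← hD]
    refine Set.ncard_le_ncard ?_ (Set.toFinite _)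
    rintro _ ⟨g, rfl⟩ x hx
    simp only [ConjAct.smul_def] at hx
    refine ht ((ConjAct.ofConjAct g)⁻¹ • x) ?_
    rw [mul_smul, mul_smul] at hx
    rw [eq_inv_smul_iff, hx]
  have hmul : (MulAction.orbit (ConjAct G) t).ncard * Nat.card (Subgroup.centralizer {t})
      = Nat.card G := by
    have h := Subgroup.card_mul_index (MulAction.stabilizer (ConjAct G) t)
    rw [MulAction.index_stabilizer, mul_comm, ConjAct.stabilizer_eq_centralizer] at h
    exact h
  rw [card_group hsharp hab] at hmul
  have hge : Fintype.card X ≤ Nat.card (Subgroup.centralizer {t}) := by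
    by_contra! hlt
    have := Nat.mul_le_mul_right (Nat.card (Subgroup.centralizer {t})) hclass
    nlinarith
  have heq := Set.eq_of_subset_of_ncard_le hsub (by rw [hK]; exact hge) (Set.toFinite _)
  exact ⟨heq, by rw [← hK, ← heq]; rfl⟩

end SharplyTwoTransitive

open SharplyTwoTransitive in
/-- Let a finite group `G` act sharply 2-transitively on a finite set `X` with at least
4 elements, and suppose the stabilizer of each point of `X` is cyclic.  Then `G` is not
generated by involutions. -/
theorem stmt_13 (G X : Type*) [Group G] [Fintype G] [Fintype X] [MulAction G X]
    (hX : 4 ≤ Fintype.card X)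
    (hsharp : ∀ a b c d : X, a ≠ b → c ≠ d → ∃! g : G, g • a = c ∧ g • b = d)
    (hcyc : ∀ x : X, IsCyclic (MulAction.stabilizer G x)) :
    ¬ Subgroup.closure {g : G | orderOf g = 2} = ⊤ := by
  classical
  intro hgen
  have : Nontrivial X := Fintype.one_lt_card_iff_nontrivial.1 (by lia)
  obtain ⟨a, b, hab⟩ := exists_pair_ne X
  obtain ⟨t, ht⟩ : {t : G | ∀ x : X, t • x ≠ x}.Nonempty := by
    rw [← Set.ncard_pos, ncard_derangements hsharp]
    lia
  obtain ⟨hK, hcard⟩ := coe_centralizer_derangement hsharp ht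
  set K := Subgroup.centralizer {t} with hKdef
  have hmem : ∀ g : G, g ∈ K ↔ g = 1 ∨ ∀ x : X, g • x ≠ x := fun g => by
    rw [← SetLike.mem_coe, hK]; rfl
  have hfix : ∀ g ∈ K, ∀ x : X, g • x = x → g = 1 := fun g hg x hx =>
    ((hmem g).1 hg).resolve_right fun h => h x hx
  have : K.Normal := ⟨fun k hk g => by
    rcases (hmem k).1 hk with rfl | hd
    · simp
    · refine (hmem _).2 (Or.inr fun x hx => hd (g⁻¹ • x) ?_)
      rw [mul_smul, mul_smul] at hx
      rw [eq_inv_smul_iff, hx]⟩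
  have hbij : Function.Bijective (fun k : K => (k : G) • a) := by
    rw [Fintype.bijective_iff_injective_and_card]
    refine ⟨fun k l hkl => ?_, by rw [← hcard, Nat.card_eq_fintype_card]⟩
    have := hfix _ (K.mul_mem (K.inv_mem l.2) k.2) a
      (by rw [mul_smul, inv_smul_eq_iff]; exact hkl)
    exact Subtype.ext (inv_mul_eq_one.1 this).symm
  have hrep : ∀ q : G ⧸ K, ∃ h : MulAction.stabilizer G a, ((h : G) : G ⧸ K) = q := by
    intro q
    obtain ⟨g, rfl⟩ := QuotientGroup.mk_surjective q
    obtain ⟨k, hk⟩ := hbij.2 (g • a)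
    refine ⟨⟨(k : G)⁻¹ * g, ?_⟩, ?_⟩
    · rw [MulAction.mem_stabilizer_iff, mul_smul, inv_smul_eq_iff]
      exact hk.symm
    · have hk1 : ((k : G) : G ⧸ K) = 1 := (QuotientGroup.eq_one_iff _).2 k.2
      rw [QuotientGroup.mk_mul, QuotientGroup.mk_inv, hk1, inv_one, one_mul]
  have := hcyc a
  have hcomm : ∀ p q : G ⧸ K, p * q = q * p := by
    intro p q
    obtain ⟨h, rfl⟩ := hrep p
    obtain ⟨l, rfl⟩ := hrep q
    have hl : h * l = l * h := (IsCyclic.isMulCommutative (α := _)).is_comm.comm h l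
    rw [← QuotientGroup.mk_mul, ← QuotientGroup.mk_mul, ← Subgroup.coe_mul, hl,
      Subgroup.coe_mul]
  obtain ⟨h, hh⟩ := IsCyclic.exists_ofOrder_eq_natCard (α := MulAction.stabilizer G a)
  have hsq : h ^ 2 = 1 := Subtype.ext
    (hfix _ (sq_mem_of_closure_involutions K hcomm hgen h) a (h ^ 2).2)
  have hle := orderOf_le_of_pow_eq_one two_pos hsq
  rw [hh, card_stabilizer hsharp hab] at hle
  lia
end
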